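/- A bipartite finite simple graph G is 1-HNG if and only if G contains no three pairwise disjoint edges (no 3K2 subgraph). -/

import Mathlib

open SimpleGraph

/-- The chromatic number of `G` as a natural number. -/
noncomputable def chi {V : Type*} (G : SimpleGraph V) : ℕ := G.chromaticNumber.toNat

/-- The clique cover number of `G`: the chromatic number of the complement. -/
noncomputable def theta {V : Type*} (G : SimpleGraph V) : ℕ := chi Gᶜ

/-- `G` is `a`-hereditary-Nordhaus-Gaddum: every induced subgraph `H`
satisfies `χ(H) + θ(H) ≥ |H| + 1 - a`. -/
def IsHNG {V : Type*} [Fintype V] (G : SimpleGraph V) (a : ℕ) : Prop :=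
  ∀ s : Finset V, s.card + 1 - a ≤ chi (G.induce (s : Set V)) + theta (G.induce (s : Set V))

/-- `G` has three pairwise disjoint edges (a `3K₂` subgraph). -/
def HasThreeDisjointEdges {V : Type*} (G : SimpleGraph V) : Prop :=
  ∃ a b c d e f : V, ([a, b, c, d, e, f] : List V).Nodup ∧
    G.Adj a b ∧ G.Adj c d ∧ G.Adj e f

theorem chi_le_of_colorable {V : Type*} {G : SimpleGraph V} {n : ℕ} (h : G.Colorable n) :
    chi G ≤ n :=
  ENat.toNat_le_of_le_natCast h.chromaticNumber_le

theorem colorable_chi {V : Type*} [Finite V] (G : SimpleGraph V) : G.Colorable (chi G) := by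
  have := Fintype.ofFinite V
  exact colorable_chromaticNumber G.colorable_of_fintype

theorem two_le_chi_of_adj {V : Type*} [Finite V] {G : SimpleGraph V} {u v : V}
    (h : G.Adj u v) : 2 ≤ chi G := by
  obtain ⟨C⟩ := colorable_chi G
  have hne := C.valid h
  by_contra! hlt
  exact hne (Fin.ext (by have := (C u).isLt; have := (C v).isLt; omega))

/-- In a map with fibers of size at most two, the domain exceeds the codomain by at most the
number of fibers with two elements. -/
theorem card_le_add_card_double_fibers {α β : Type*} [Fintype α] [Fintype β] [DecidableEq β]
    (f : α → β) (h : ∀ b, (Finset.univ.filter fun a => f a = b).card ≤ 2) :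
    Fintype.card α ≤ Fintype.card β +
      (Finset.univ.filter fun b => 1 < (Finset.univ.filter fun a => f a = b).card).card := by
  rw [Finset.card_filter, ← Finset.card_univ (α := α), ← Finset.card_univ (α := β),
    Finset.card_eq_sum_card_fiberwise (f := f) (t := Finset.univ) (by simp),
    Finset.card_eq_sum_ones (Finset.univ : Finset β), ← Finset.sum_add_distrib]
  refine Finset.sum_le_sum fun b _ => ?_
  have := h b
  split_ifs <;> omega

theorem HasThreeDisjointEdges.of_induce {V : Type*} {G : SimpleGraph V} {s : Set V}
    (h : HasThreeDisjointEdges (G.induce s)) : HasThreeDisjointEdges G := by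
  obtain ⟨a, b, c, d, e, f, hn, hab, hcd, hef⟩ := h
  exact ⟨a, b, c, d, e, f, hn.map Subtype.val_injective, hab, hcd, hef⟩

theorem card_le_chi_add_theta {V : Type*} [Fintype V] (G : SimpleGraph V) (hG : G.CliqueFree 3)
    (h : ¬ HasThreeDisjointEdges G) : Fintype.card V ≤ chi G + theta G := by
  classical
  obtain ⟨C⟩ := colorable_chi Gᶜ
  have adj_of_eq {u v : V} (hne : u ≠ v) (hc : C u = C v) : G.Adj u v := by
    by_contra hn
    exact C.valid ((G.compl_adj u v).2 ⟨hne, hn⟩) hc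
  have hfib (b) : (Finset.univ.filter fun a => C a = b).card ≤ 2 := by
    by_contra! hlt
    obtain ⟨x, y, z, hx, hy, hz, hxy, hxz, hyz⟩ := Finset.two_lt_card_iff.1 hlt
    simp only [Finset.mem_filter, Finset.mem_univ, true_and] at hx hy hz
    exact hG {x, y, z} (is3Clique_triple_iff.2 ⟨adj_of_eq hxy (hx.trans hy.symm),
      adj_of_eq hxz (hx.trans hz.symm), adj_of_eq hyz (hy.trans hz.symm)⟩)
  have hcard := card_le_add_card_double_fibers C hfib
  rw [Fintype.card_fin] at hcard
  set D := Finset.univ.filter fun b => 1 < (Finset.univ.filter fun a => C a = b).card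
  have hedge {b} (hb : b ∈ D) : ∃ u v, G.Adj u v ∧ C u = b ∧ C v = b := by
    obtain ⟨u, v, hu, hv, huv⟩ := Finset.one_lt_card_iff.1 (Finset.mem_filter.1 hb).2
    simp only [Finset.mem_filter, Finset.mem_univ, true_and] at hu hv
    exact ⟨u, v, adj_of_eq huv (hu.trans hv.symm), hu, hv⟩
  have hD2 : D.card ≤ 2 := by
    by_contra! hlt
    obtain ⟨x, y, z, hx, hy, hz, hxy, hxz, hyz⟩ := Finset.two_lt_card_iff.1 hlt
    obtain ⟨a, b, hab, ha, hb⟩ := hedge hx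
    obtain ⟨c, d, hcd, hc, hd⟩ := hedge hy
    obtain ⟨e, f, hef, he, hf⟩ := hedge hz
    refine h ⟨a, b, c, d, e, f, ?_, hab, hcd, hef⟩
    have := hab.ne
    have := hcd.ne
    have := hef.ne
    have ne_of_color {u v : V} (huv : C u ≠ C v) : u ≠ v := fun h => huv (congrArg C h)
    simp only [List.nodup_cons, List.mem_cons, List.not_mem_nil, List.nodup_nil, not_or]
    refine ⟨⟨?_, ?_, ?_, ?_, ?_, id⟩, ⟨?_, ?_, ?_, ?_, id⟩, ⟨?_, ?_, ?_, id⟩, ⟨?_, ?_, id⟩,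
      ⟨?_, id⟩, id, trivial⟩ <;>
      first | assumption | (apply ne_of_color; simp_all only [ne_eq, not_false_eq_true])
  have hchi : D.card ≤ chi G := by
    rcases D.eq_empty_or_nonempty with h0 | ⟨b, hb⟩
    · simp [h0]
    · obtain ⟨u, v, huv, -⟩ := hedge hb
      exact hD2.trans (two_le_chi_of_adj huv)
  unfold theta
  omega

theorem colorable_two_of_partition {V : Type*} {G : SimpleGraph V} {A B : Set V}
    (hAB : A ∪ B = Set.univ) (hA : A.Pairwise fun x y => ¬ G.Adj x y)
    (hB : B.Pairwise fun x y => ¬ G.Adj x y) : G.Colorable 2 := by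
  classical
  have hmem (v : V) : v ∈ A ∨ v ∈ B := Set.eq_univ_iff_forall.1 hAB v
  refine ⟨Coloring.mk (fun v => if v ∈ A then 0 else 1) fun {u v} huv => ?_⟩
  by_cases hu : u ∈ A <;> by_cases hv : v ∈ A
  · exact absurd huv (hA hu hv huv.ne)
  · simp [hu, hv]
  · simp [hu, hv]
  · exact absurd huv (hB ((hmem u).resolve_left hu) ((hmem v).resolve_left hv) huv.ne)

/-- The six endpoints of three disjoint edges induce a subgraph covered by three cliques. -/
theorem HasThreeDisjointEdges.exists_theta_le {V : Type*} {G : SimpleGraph V}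
    (h : HasThreeDisjointEdges G) :
    ∃ s : Finset V, s.card = 6 ∧ theta (G.induce (s : Set V)) ≤ 3 := by
  classical
  obtain ⟨a, b, c, d, e, f, hn, hab, hcd, hef⟩ := h
  refine ⟨[a, b, c, d, e, f].toFinset, List.toFinset_card_of_nodup hn, chi_le_of_colorable ?_⟩
  refine ⟨Coloring.mk (fun v => if v.1 = a ∨ v.1 = b then 0 else if v.1 = c ∨ v.1 = d then 1
    else 2) ?_⟩
  rintro ⟨u, hu⟩ ⟨v, hv⟩ huv
  have hne : u ≠ v := fun h => huv.ne (Subtype.ext h)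
  have hnadj : ¬ G.Adj u v := ((compl_adj _ _ _).1 huv).2
  simp only [List.coe_toFinset, List.mem_cons, List.not_mem_nil, or_false,
    Set.mem_ofPred_eq] at hu hv
  have := hab.symm
  have := hcd.symm
  have := hef.symm
  have h01 : (0 : Fin 3) ≠ 1 := by decide
  have h02 : (0 : Fin 3) ≠ 2 := by decide
  have h12 : (1 : Fin 3) ≠ 2 := by decide
  grind

/-- A bipartite graph is `1`-HNG iff it has no three pairwise disjoint edges. -/
theorem stmt_16 {V : Type*} [Fintype V] (G : SimpleGraph V)
    (hbip : ∃ A B : Set V, A ∪ B = Set.univ ∧ Disjoint A B ∧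
      (A.Pairwise fun x y => ¬ G.Adj x y) ∧ (B.Pairwise fun x y => ¬ G.Adj x y)) :
    IsHNG G 1 ↔ ¬ HasThreeDisjointEdges G := by
  obtain ⟨A, B, hAB, -, hA, hB⟩ := hbip
  have hcol := colorable_two_of_partition hAB hA hB
  constructor
  · intro hG h3
    obtain ⟨s, hs, htheta⟩ := h3.exists_theta_le
    have hle := hG s
    have hchi : chi (G.induce (s : Set V)) ≤ 2 :=
      chi_le_of_colorable (hcol.of_hom (Embedding.induce (s : Set V)).toHom)
    omega
  · intro h3 s
    have hcf : (G.induce (s : Set V)).CliqueFree 3 :=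
      (hcol.of_hom (Embedding.induce (s : Set V)).toHom).cliqueFree (by norm_num)
    have := card_le_chi_add_theta _ hcf fun h => h3 h.of_induce
    simpa using this
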